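/- For every γ ∈ [a,b] one has q^{−γ} h_q(γ) ≤ C(γ) ≤ q^{γ} h_q(γ), where h_q(γ) = ∫_ℝ |θ|^γ φ(θ) dθ. In particular h_q is strictly positive and finite on [a,b]. -/

import Mathlib

open MeasureTheory

/-- C(γ) = 2/π if γ = 1 and (1−γ)/(Γ(2−γ)cos(πγ/2)) otherwise. -/
noncomputable def Cfun (γ : ℝ) : ℝ :=
  if γ = 1 then 2 / Real.pi
  else (1 - γ) / (Real.Gamma (2 - γ) * Real.cos (Real.pi * γ / 2))

/-- h_q(γ) = ∫_ℝ |θ|^γ φ(θ) dθ. -/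
noncomputable def hq (φ : ℝ → ℝ) (γ : ℝ) : ℝ :=
  ∫ θ : ℝ, |θ| ^ γ * φ θ

open Set Filter Topology in
/-- Tonelli's theorem on a quadrant for nonnegative functions, in terms of Bochner integrals. -/
lemma integrableOn_Ioi_and_integral_eq_of_swap {f : ℝ → ℝ → ℝ} {g h : ℝ → ℝ}
    (hf : Measurable (Function.uncurry f)) (hpos : ∀ x > 0, ∀ y > 0, 0 ≤ f x y)
    (hfint : ∀ y > 0, IntegrableOn (fun x => f x y) (Ioi 0))
    (hfh : ∀ y > 0, ∫ x in Ioi 0, f x y = h y) (hh : IntegrableOn h (Ioi 0))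
    (hfg : ∀ x > 0, ∫ y in Ioi 0, f x y = g x) :
    IntegrableOn g (Ioi 0) ∧ ∫ x in Ioi 0, g x = ∫ y in Ioi 0, h y := by
  have hprod : Integrable (Function.uncurry f)
      ((volume.restrict (Ioi 0)).prod (volume.restrict (Ioi 0))) := by
    refine (integrable_prod_iff' hf.aestronglyMeasurable).2 ⟨?_, ?_⟩
    · filter_upwards [ae_restrict_mem measurableSet_Ioi] with y hy using hfint y hy
    · refine IntegrableOn.congr_fun hh (fun y hy => ?_) measurableSet_Ioi
      rw [← hfh y hy]
      refine setIntegral_congr_fun measurableSet_Ioi fun x hx => ?_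
      exact (Real.norm_of_nonneg (hpos x hx y hy)).symm
  constructor
  · exact IntegrableOn.congr_fun hprod.integral_prod_left (fun x hx => hfg x hx) measurableSet_Ioi
  · rw [← setIntegral_congr_fun measurableSet_Ioi (fun x hx => hfg x hx),
      ← setIntegral_congr_fun measurableSet_Ioi (fun y hy => hfh y hy)]
    exact integral_integral_swap hprod

open Set Filter Topology in
lemma integral_rpow_div_one_add_sq {γ : ℝ} (h0 : 0 < γ) (h2 : γ < 2) :
    IntegrableOn (fun t : ℝ => t ^ (γ - 1) / (1 + t ^ 2)) (Ioi 0) ∧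
      ∫ t in Ioi (0 : ℝ), t ^ (γ - 1) / (1 + t ^ 2) = Real.pi / (2 * Real.sin (Real.pi * γ / 2)) := by
  have hΓ : Real.Gamma (γ / 2) * Real.Gamma (1 - γ / 2) = Real.pi / Real.sin (Real.pi * γ / 2) := by
    rw [Real.Gamma_mul_Gamma_one_sub, mul_div_assoc]
  obtain ⟨hi, he⟩ := integrableOn_Ioi_and_integral_eq_of_swap
    (f := fun t s => t ^ (γ - 1) * Real.exp (-s * (1 + t ^ 2)))
    (g := fun t => t ^ (γ - 1) / (1 + t ^ 2))
    (h := fun s => 1 / 2 * Real.Gamma (γ / 2) * (s ^ (-γ / 2) * Real.exp (-1 * s ^ (1 : ℝ))))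
    (by fun_prop) (fun t ht s hs => by positivity)
    (fun s hs => by
      refine IntegrableOn.congr_fun
        ((integrableOn_rpow_mul_exp_neg_mul_rpow (s := γ - 1) (p := 2) (b := s) (by linarith)
        (by norm_num) hs).const_mul (Real.exp (-s))) (fun t ht => ?_) measurableSet_Ioi
      rw [mul_left_comm, ← Real.exp_add, Real.rpow_two]
      ring_nf)
    (fun s hs => by
      have := integral_rpow_mul_exp_neg_mul_rpow (q := γ - 1) (p := 2) (b := s) (by norm_num)
        (by linarith) hs
      rw [sub_add_cancel] at this
      calc _ = ∫ t in Ioi (0 : ℝ), Real.exp (-s) * (t ^ (γ - 1) * Real.exp (-s * t ^ (2 : ℝ))) := by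
            refine setIntegral_congr_fun measurableSet_Ioi fun t ht => ?_
            rw [mul_left_comm, ← Real.exp_add, Real.rpow_two]
            ring_nf
        _ = _ := by
            rw [integral_const_mul, this, Real.rpow_one]
            ring_nf)
    ((integrableOn_rpow_mul_exp_neg_mul_rpow (by linarith) (by norm_num) (by norm_num)).const_mul _)
    (fun t ht => by
      have := Real.integral_rpow_mul_exp_neg_mul_Ioi (a := 1) (r := 1 + t ^ 2) (by norm_num)
        (by positivity)
      simp only [sub_self, Real.rpow_zero, one_mul, Real.rpow_one, Real.Gamma_one, mul_one] at this
      rw [integral_const_mul, div_eq_mul_one_div, ← this]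
      congr 2
      ext s
      ring_nf)
  refine ⟨hi, he.trans ?_⟩
  rw [integral_const_mul, integral_rpow_mul_exp_neg_mul_rpow (by norm_num) (by linarith)
    (by norm_num)]
  rw [show (-γ / 2 + 1) / 1 = 1 - γ / 2 by ring]
  simp only [Real.one_rpow, one_div, inv_one, mul_one, one_mul]
  rw [mul_assoc, hΓ, mul_comm 2, ← div_div]
  ring

open Set Filter Topology in
lemma integral_one_sub_cos_mul_exp {t : ℝ} (ht : 0 < t) :
    IntegrableOn (fun x : ℝ => (1 - Real.cos x) * Real.exp (-t * x)) (Ioi 0) ∧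
      ∫ x in Ioi (0 : ℝ), (1 - Real.cos x) * Real.exp (-t * x) = 1 / (t * (1 + t ^ 2)) := by
  let F : ℝ → ℝ := fun x => Real.exp (-t * x) *
    (-1 / t - (Real.sin x - t * Real.cos x) / (1 + t ^ 2))
  have hd : ∀ x ∈ Ici (0 : ℝ), HasDerivAt F ((1 - Real.cos x) * Real.exp (-t * x)) x := by
    intro x _
    have h1 : HasDerivAt (fun x => Real.exp (-t * x)) (Real.exp (-t * x) * (-t * 1)) x :=
      ((hasDerivAt_id x).const_mul (-t)).exp
    have h2 := (((Real.hasDerivAt_sin x).sub ((Real.hasDerivAt_cos x).const_mul t)).div_const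
      (1 + t ^ 2)).const_sub (-1 / t)
    refine (h1.mul h2).congr_deriv ?_
    simp only [Pi.sub_apply]
    field_simp
    ring
  have hlim : Tendsto F atTop (𝓝 0) := by
    have h1 : Tendsto (fun x => Real.exp (-t * x)) atTop (𝓝 0) := by
      refine Real.tendsto_exp_atBot.comp ?_
      exact tendsto_id.const_mul_atTop_of_neg (by linarith)
    refine h1.zero_mul_isBoundedUnder_le ?_
    refine isBoundedUnder_of ⟨1 / t + (1 + t) / (1 + t ^ 2), fun x => ?_⟩
    simp only [Function.comp_apply]
    refine (norm_sub_le _ _).trans (add_le_add ?_ ?_)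
    · rw [norm_div, norm_neg, norm_one, Real.norm_of_nonneg ht.le]
    · rw [norm_div, Real.norm_of_nonneg (by positivity : 0 ≤ 1 + t ^ 2)]
      gcongr
      refine (norm_sub_le _ _).trans (add_le_add (Real.abs_sin_le_one x) ?_)
      rw [norm_mul, Real.norm_of_nonneg ht.le]
      exact mul_le_of_le_one_right ht.le (Real.abs_cos_le_one x)
  have hnn : ∀ x ∈ Ioi (0 : ℝ), 0 ≤ (1 - Real.cos x) * Real.exp (-t * x) := fun x _ =>
    mul_nonneg (by linarith [Real.cos_le_one x]) (Real.exp_pos _).le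
  refine ⟨integrableOn_Ioi_deriv_of_nonneg' hd hnn hlim, ?_⟩
  rw [integral_Ioi_of_hasDerivAt_of_nonneg' hd hnn hlim]
  simp only [F, mul_zero, Real.exp_zero, Real.sin_zero, Real.cos_zero]
  field_simp
  ring

lemma Cfun_eq {γ : ℝ} (h0 : 0 < γ) (h2 : γ < 2) :
    Cfun γ = 2 * Real.Gamma γ * Real.sin (Real.pi * γ / 2) / Real.pi := by
  unfold Cfun
  split_ifs with h
  · subst h
    simp
  · have hr := Real.Gamma_mul_Gamma_one_sub γ
    have hs : Real.sin (Real.pi * γ) =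
        2 * Real.sin (Real.pi * γ / 2) * Real.cos (Real.pi * γ / 2) := by
      rw [← Real.sin_two_mul]
      ring_nf
    have h1 : (1 - γ) ≠ 0 := sub_ne_zero.2 (Ne.symm h)
    have hG : Real.Gamma (2 - γ) = (1 - γ) * Real.Gamma (1 - γ) := by
      rw [← Real.Gamma_add_one h1]
      ring_nf
    have hsin : 0 < Real.sin (Real.pi * γ / 2) :=
      Real.sin_pos_of_pos_of_lt_pi (by positivity) (by nlinarith [Real.pi_pos])
    have hcos : Real.cos (Real.pi * γ / 2) ≠ 0 := by
      rcases lt_or_gt_of_ne h with h | h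
      · exact (Real.cos_pos_of_mem_Ioo
          ⟨by nlinarith [Real.pi_pos], by nlinarith [Real.pi_pos]⟩).ne'
      · exact (Real.cos_neg_of_pi_div_two_lt_of_lt
          (by nlinarith [Real.pi_pos]) (by nlinarith [Real.pi_pos])).ne
    have hΓ : Real.Gamma (2 - γ) ≠ 0 := (Real.Gamma_pos_of_pos (by linarith)).ne'
    have hΓ1 : Real.Gamma (1 - γ) ≠ 0 := fun h => hΓ (by rw [hG, h, mul_zero])
    rw [hs, eq_div_iff (by positivity)] at hr
    rw [hG, div_eq_div_iff (by positivity) Real.pi_ne_zero]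
    linear_combination -(1 - γ) * hr

lemma Cfun_pos {γ : ℝ} (h0 : 0 < γ) (h2 : γ < 2) : 0 < Cfun γ := by
  have hsin : 0 < Real.sin (Real.pi * γ / 2) :=
    Real.sin_pos_of_pos_of_lt_pi (by positivity) (by nlinarith [Real.pi_pos])
  have := Real.Gamma_pos_of_pos h0
  rw [Cfun_eq h0 h2]
  positivity

open Set in
lemma integral_one_sub_cos_mul_rpow {γ : ℝ} (h0 : 0 < γ) (h2 : γ < 2) :
    IntegrableOn (fun x : ℝ => (1 - Real.cos x) * x ^ (-1 - γ)) (Ioi 0) ∧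
      ∫ x in Ioi (0 : ℝ), (1 - Real.cos x) * x ^ (-1 - γ) = 1 / (γ * Cfun γ) := by
  have hΓ := Real.Gamma_pos_of_pos (by linarith : 0 < γ + 1)
  have hsin : 0 < Real.sin (Real.pi * γ / 2) :=
    Real.sin_pos_of_pos_of_lt_pi (by positivity) (by nlinarith [Real.pi_pos])
  obtain ⟨hJi, hJ⟩ := integral_rpow_div_one_add_sq h0 h2
  obtain ⟨hi, he⟩ := integrableOn_Ioi_and_integral_eq_of_swap
    (f := fun x t => (Real.Gamma (γ + 1))⁻¹ * (t ^ γ * ((1 - Real.cos x) * Real.exp (-t * x))))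
    (g := fun x => (1 - Real.cos x) * x ^ (-1 - γ))
    (h := fun t => (Real.Gamma (γ + 1))⁻¹ * (t ^ (γ - 1) / (1 + t ^ 2)))
    (by fun_prop)
    (fun x hx t ht => by
      have := Real.cos_le_one x
      have : 0 ≤ 1 - Real.cos x := by linarith
      positivity)
    (fun t ht => ((integral_one_sub_cos_mul_exp ht).1.const_mul _).const_mul _)
    (fun t ht => by
      rw [integral_const_mul, integral_const_mul, (integral_one_sub_cos_mul_exp ht).2,
        Real.rpow_sub_one ht.ne']
      field_simp)
    (hJi.const_mul _)
    (fun x hx => by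
      have := Real.integral_rpow_mul_exp_neg_mul_Ioi (a := γ + 1) (by linarith) hx
      rw [add_sub_cancel_right] at this
      calc _ = ∫ t in Ioi (0 : ℝ), (Real.Gamma (γ + 1))⁻¹ * (1 - Real.cos x) *
            (t ^ γ * Real.exp (-(x * t))) := by
            congr 1
            ext t
            ring_nf
        _ = _ := by
            rw [integral_const_mul, this, one_div, Real.inv_rpow (le_of_lt hx),
              ← Real.rpow_neg (le_of_lt hx)]
            field_simp
            ring_nf)
  refine ⟨hi, he.trans ?_⟩
  rw [integral_const_mul, hJ, Cfun_eq h0 h2, Real.Gamma_add_one h0.ne']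
  have := Real.Gamma_pos_of_pos h0
  field_simp

open Set in
lemma integral_one_sub_cos_mul_mul_rpow {γ : ℝ} (h0 : 0 < γ) (h2 : γ < 2) (θ : ℝ) :
    IntegrableOn (fun x : ℝ => (1 - Real.cos (θ * x)) * x ^ (-1 - γ)) (Ioi 0) ∧
      ∫ x in Ioi (0 : ℝ), (1 - Real.cos (θ * x)) * x ^ (-1 - γ) =
        |θ| ^ γ * (1 / (γ * Cfun γ)) := by
  rcases eq_or_ne θ 0 with rfl | hθ
  · simp [Real.zero_rpow h0.ne']
  have hθ' : 0 < |θ| := abs_pos.2 hθ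
  obtain ⟨hi, he⟩ := integral_one_sub_cos_mul_rpow h0 h2
  have heq : ∀ x ∈ Ioi (0 : ℝ), |θ| ^ (1 + γ) * ((1 - Real.cos (|θ| * x)) * (|θ| * x) ^ (-1 - γ)) =
      (1 - Real.cos (θ * x)) * x ^ (-1 - γ) := by
    intro x hx
    have hx' : 0 < x := hx
    have hc : Real.cos (|θ| * x) = Real.cos (θ * x) := by
      rw [← Real.cos_abs (θ * x), abs_mul, abs_of_pos hx']
    have h1 : |θ| ^ (1 + γ) * |θ| ^ (-1 - γ) = 1 := by
      rw [← Real.rpow_add hθ']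
      ring_nf
      simp
    rw [hc, Real.mul_rpow hθ'.le hx'.le]
    linear_combination (1 - Real.cos (θ * x)) * x ^ (-1 - γ) * h1
  constructor
  · refine IntegrableOn.congr_fun (Integrable.const_mul ?_ (|θ| ^ (1 + γ))) heq measurableSet_Ioi
    have := (integrableOn_Ioi_comp_mul_left_iff
      (fun x : ℝ => (1 - Real.cos x) * x ^ (-1 - γ)) 0 hθ').2 (by rwa [mul_zero])
    exact this
  · rw [← setIntegral_congr_fun measurableSet_Ioi heq, integral_const_mul,
      integral_comp_mul_left_Ioi (fun x : ℝ => (1 - Real.cos x) * x ^ (-1 - γ)) 0 hθ', mul_zero,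
      he, Real.rpow_add hθ', Real.rpow_one, smul_eq_mul]
    field_simp

open Set in
/-- The absolute moment of `φ` of order `γ`, expressed through its cosine transform. -/
lemma hq_eq_integral {γ : ℝ} (h0 : 0 < γ) (h2 : γ < 2) {φ ψ : ℝ → ℝ} (hφ : Integrable φ)
    (hmom : Integrable (fun θ : ℝ => |θ| ^ γ * φ θ))
    (hψ : ∀ x, ∫ θ, (1 - Real.cos (θ * x)) * φ θ = ψ x) :
    IntegrableOn (fun x : ℝ => x ^ (-1 - γ) * ψ x) (Ioi 0) ∧
      hq φ γ = γ * Cfun γ * ∫ x in Ioi (0 : ℝ), x ^ (-1 - γ) * ψ x := by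
  have hC := Cfun_pos h0 h2
  let f : ℝ → ℝ → ℝ := fun θ x => (1 - Real.cos (θ * x)) * x ^ (-1 - γ) * φ θ
  have hf : Integrable (Function.uncurry f) (volume.prod (volume.restrict (Ioi 0))) := by
    refine (integrable_prod_iff ?_).2 ⟨?_, ?_⟩
    · refine AEStronglyMeasurable.mul (Measurable.aestronglyMeasurable ?_) hφ.1.comp_fst
      fun_prop
    · exact .of_forall fun θ => (integral_one_sub_cos_mul_mul_rpow h0 h2 θ).1.mul_const (φ θ)
    · refine (hmom.norm.const_mul (1 / (γ * Cfun γ))).congr (.of_forall fun θ => ?_)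
      dsimp only
      rw [norm_mul, Real.norm_of_nonneg (by positivity : 0 ≤ |θ| ^ γ), ← mul_assoc,
        mul_comm (1 / (γ * Cfun γ)), ← (integral_one_sub_cos_mul_mul_rpow h0 h2 θ).2,
        ← integral_mul_const]
      refine setIntegral_congr_fun measurableSet_Ioi fun x hx => ?_
      have hx' : 0 < x := hx
      have h1 : 0 ≤ 1 - Real.cos (θ * x) := by linarith [Real.cos_le_one (θ * x)]
      simp only [Function.uncurry, f]
      rw [norm_mul _ (φ θ),
        Real.norm_of_nonneg (by positivity : 0 ≤ (1 - Real.cos (θ * x)) * x ^ (-1 - γ))]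
  have hx : ∀ x, ∫ θ, f θ x = x ^ (-1 - γ) * ψ x := fun x => by
    rw [← hψ, ← integral_const_mul]
    congr 1
    ext θ
    simp only [f]
    ring
  constructor
  · exact hf.integral_prod_right.congr (.of_forall hx)
  · have := integral_integral_swap hf
    simp only [hx] at this
    rw [← this]
    simp only [f, integral_mul_const, (integral_one_sub_cos_mul_mul_rpow h0 h2 _).2]
    rw [hq, ← integral_const_mul]
    congr 1
    ext θ
    field_simp

open Set in
lemma integral_one_sub_cos_mul_of_fourier {φ φhat : ℝ → ℝ} (hφ : Integrable φ)
    (hφhat : ∀ x : ℝ, (φhat x : ℂ) = ∫ θ : ℝ, Complex.exp (-(Complex.I * x * θ)) * (φ θ : ℂ))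
    (x : ℝ) : ∫ θ, (1 - Real.cos (θ * x)) * φ θ = φhat 0 - φhat x := by
  have hcint : ∀ y : ℝ, Integrable (fun θ => Real.cos (θ * y) * φ θ) := fun y =>
    hφ.bdd_mul (c := 1) (by fun_prop) (.of_forall fun θ => Real.abs_cos_le_one _)
  have hcos : ∀ y, φhat y = ∫ θ, Real.cos (θ * y) * φ θ := by
    intro y
    have hint : Integrable (fun θ : ℝ => Complex.exp (-(Complex.I * y * θ)) * (φ θ : ℂ)) := by
      refine hφ.ofReal.bdd_mul (c := 1) (by fun_prop) (.of_forall fun θ => ?_)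
      rw [Complex.norm_exp]
      simp
    rw [← Complex.ofReal_re (φhat y), hφhat, ← RCLike.re_eq_complex_re, ← integral_re hint]
    congr 1
    ext θ
    rw [RCLike.re_eq_complex_re, Complex.re_mul_ofReal, Complex.exp_re]
    simp [mul_comm]
  simp only [sub_mul]
  rw [integral_sub (by simpa using hcint 0) (hcint x), hcos, hcos]
  simp

/-- for every γ ∈ [a,b], q^{−γ} h_q(γ) ≤ C(γ) ≤ q^{γ} h_q(γ); in particular
h_q is strictly positive (and finite) on [a,b]. -/
theorem C_bounds_by_hq
    (a b : ℝ) (ha : 0 < a) (hab : a < b) (hb : b < 2)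
    (q : ℝ) (hq1 : 1 < q)
    (φ : ℝ → ℝ) (hφeven : ∀ θ, φ (-θ) = φ θ) (hφint : Integrable φ)
    (hφmom : ∀ γ ∈ Set.Ico (0 : ℝ) 4, Integrable (fun θ : ℝ => (1 + |θ|) ^ γ * |φ θ|))
    (φhat : ℝ → ℝ)
    (hφhat : ∀ x : ℝ, (φhat x : ℂ) = ∫ θ : ℝ, Complex.exp (-(Complex.I * x * θ)) * (φ θ : ℂ))
    (hφhat01 : ∀ x, φhat x ∈ Set.Icc (0 : ℝ) 1)
    (hφhat1 : ∀ x : ℝ, |x| ≤ 1 → φhat x = 1)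
    (hφhat0 : ∀ x : ℝ, (1 + q) / 2 ≤ |x| → φhat x = 0) :
    ∀ γ ∈ Set.Icc a b,
      q ^ (-γ) * hq φ γ ≤ Cfun γ ∧ Cfun γ ≤ q ^ γ * hq φ γ ∧ 0 < hq φ γ := by
  intro γ hγ
  obtain ⟨hγa, hγb⟩ := hγ
  have h0 : 0 < γ := ha.trans_le hγa
  have h2 : γ < 2 := hγb.trans_lt hb
  have hC := Cfun_pos h0 h2
  have hmom : Integrable (fun θ : ℝ => |θ| ^ γ * φ θ) := by
    refine (hφmom γ ⟨h0.le, by linarith⟩).mono ?_ (.of_forall fun θ => ?_)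
    · exact AEStronglyMeasurable.mul (Measurable.aestronglyMeasurable (by fun_prop)) hφint.1
    · rw [norm_mul, norm_mul, norm_abs_eq_norm (φ θ),
        Real.norm_of_nonneg (by positivity : 0 ≤ |θ| ^ γ),
        Real.norm_of_nonneg (by positivity : 0 ≤ (1 + |θ|) ^ γ)]
      gcongr
      linarith
  obtain ⟨hint, hh⟩ := hq_eq_integral h0 h2 hφint hmom
    (integral_one_sub_cos_mul_of_fourier hφint hφhat)
  rw [hφhat1 0 (by simp)] at hint hh
  set I := ∫ x in Set.Ioi (0 : ℝ), x ^ (-1 - γ) * (1 - φhat x) with hI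
  have hR : 0 < (1 + q) / 2 := by linarith
  have hupper : I ≤ 1 / γ := by
    have h1 : I = ∫ x in Set.Ioi (1 : ℝ), x ^ (-1 - γ) * (1 - φhat x) := by
      refine (setIntegral_eq_of_subset_of_forall_sdiff_eq_zero measurableSet_Ioi
        (Set.Ioi_subset_Ioi zero_le_one) fun x hx => ?_)
      have hx0 : 0 < x := hx.1
      have hx1 : x ≤ 1 := not_lt.1 hx.2
      rw [hφhat1 x (by rwa [abs_of_pos hx0]), sub_self, mul_zero]
    have h3 := integral_Ioi_rpow_of_lt (by linarith : -1 - γ < -1) zero_lt_one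
    rw [Real.one_rpow, show -1 - γ + 1 = -γ by ring, neg_div_neg_eq] at h3
    rw [h1, ← h3]
    refine setIntegral_mono_on (hint.mono_set (Set.Ioi_subset_Ioi zero_le_one))
      (integrableOn_Ioi_rpow_of_lt (by linarith) zero_lt_one) measurableSet_Ioi fun x hx => ?_
    have hx0 : 0 < x := zero_lt_one.trans hx
    exact mul_le_of_le_one_right (by positivity) (by linarith [(hφhat01 x).1])
  have hlower : ((1 + q) / 2) ^ (-γ) / γ ≤ I := by
    have h3 := integral_Ioi_rpow_of_lt (by linarith : -1 - γ < -1) hR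
    rw [show -1 - γ + 1 = -γ by ring, neg_div_neg_eq] at h3
    rw [← h3]
    calc ∫ x in Set.Ioi ((1 + q) / 2), x ^ (-1 - γ)
        = ∫ x in Set.Ioi ((1 + q) / 2), x ^ (-1 - γ) * (1 - φhat x) := by
          refine setIntegral_congr_fun measurableSet_Ioi fun x hx => ?_
          rw [hφhat0 x ((le_of_lt hx).trans (le_abs_self x)), sub_zero, mul_one]
      _ ≤ I := by
          refine setIntegral_mono_set hint ?_ (Set.Ioi_subset_Ioi hR.le).eventuallyLE
          filter_upwards [ae_restrict_mem measurableSet_Ioi] with x hx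
          have hx0 : 0 < x := hx
          exact mul_nonneg (by positivity) (by linarith [(hφhat01 x).2])
  have hle : hq φ γ ≤ Cfun γ := by
    rw [hh]
    calc γ * Cfun γ * I ≤ γ * Cfun γ * (1 / γ) := by gcongr
      _ = Cfun γ := by field_simp
  have hge : q ^ (-γ) * Cfun γ ≤ hq φ γ := by
    have h1 : q ^ (-γ) ≤ ((1 + q) / 2) ^ (-γ) :=
      Real.rpow_le_rpow_of_nonpos hR (by linarith) (by linarith)
    rw [hh]
    calc q ^ (-γ) * Cfun γ ≤ ((1 + q) / 2) ^ (-γ) * Cfun γ := by gcongr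
      _ = γ * Cfun γ * (((1 + q) / 2) ^ (-γ) / γ) := by field_simp
      _ ≤ γ * Cfun γ * I := by gcongr
  have hq0 : 0 < q := by linarith
  have hpos : 0 < hq φ γ := lt_of_lt_of_le (by positivity) hge
  refine ⟨?_, ?_, hpos⟩
  · refine (mul_le_of_le_one_left hpos.le ?_).trans hle
    exact Real.rpow_le_one_of_one_le_of_nonpos hq1.le (by linarith)
  · rwa [Real.rpow_neg hq0.le, inv_mul_le_iff₀ (by positivity)] at hge
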